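/- Let A be an MPS tensor with physical dimension d. Then there exists K ≥ 1, an integer L ≥ 0, pairwise essentially different normal MPS tensors B_1,…,B_L with physical dimension d^K, and complex numbers μ_{ij} (1 ≤ i ≤ L, 1 ≤ j ≤ M_i) such that for every n ≥ 1, V_{Kn}(A) = ∑_{i=1}^L (∑_{j=1}^{M_i} μ_{ij}^n) · V_n(B_i), where V_n(B_i) ∈ ℂ^{(d^K)^n} is identified with a vector in ℂ^{d^{Kn}} via the natural grouping of Kn physical indices into n blocks of K. -/

import Mathlib

open Matrix
open scoped ComplexOrder

noncomputable section

/-- The ordered product `A^{i_1} ⋯ A^{i_n}` of the matrices of an MPS tensor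
(with physical index type `ι`) along an index string `i`. -/
def mpsProd {D : ℕ} {ι : Type*} (A : ι → Matrix (Fin D) (Fin D) ℂ) {n : ℕ}
    (i : Fin n → ι) : Matrix (Fin D) (Fin D) ℂ :=
  (List.ofFn fun k => A (i k)).prod

/-- The components of the MPS vector: `V_n(A)_{i_1…i_n} = Tr(A^{i_1}⋯A^{i_n})`. -/
def Vn {D : ℕ} {ι : Type*} (A : ι → Matrix (Fin D) (Fin D) ℂ) (n : ℕ) :
    (Fin n → ι) → ℂ :=
  fun i => (mpsProd A i).trace

/-- The transfer map `T_A : ρ ↦ ∑ i, A i * ρ * (A i)ᴴ` of an MPS tensor. -/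
def transferMap {D : ℕ} {ι : Type*} [Fintype ι] (A : ι → Matrix (Fin D) (Fin D) ℂ)
    (ρ : Matrix (Fin D) (Fin D) ℂ) : Matrix (Fin D) (Fin D) ℂ :=
  ∑ i, A i * ρ * (A i)ᴴ

/-- `A` is normal: some iterate of the transfer map sends every nonzero
positive semidefinite matrix to a positive definite matrix. -/
def IsPrimitive {D : ℕ} {ι : Type*} [Fintype ι] (A : ι → Matrix (Fin D) (Fin D) ℂ) : Prop :=
  ∃ n : ℕ, 1 ≤ n ∧ ∀ ρ : Matrix (Fin D) (Fin D) ℂ, ρ.PosSemidef → ρ ≠ 0 →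
    ((transferMap A)^[n] ρ).PosDef

/-- Two MPS tensors with the same physical index type are essentially different if there
is no `λ ∈ ℂ` with `V_n(A) = λ^n V_n(B)` for all `n ≥ 1`. -/
def EssentiallyDifferent {DA DB : ℕ} {ι : Type*} (A : ι → Matrix (Fin DA) (Fin DA) ℂ)
    (B : ι → Matrix (Fin DB) (Fin DB) ℂ) : Prop :=
  ¬ ∃ lam : ℂ, ∀ n : ℕ, 1 ≤ n → ∀ i : Fin n → ι, Vn A n i = lam ^ n * Vn B n i

/-- **Burnside's theorem**: a subalgebra of the endomorphisms of a finite-dimensional complex vector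
space without nontrivial invariant subspaces consists of all endomorphisms. -/
theorem eq_top_of_forall_invariant {V : Type*} [AddCommGroup V] [Module ℂ V]
    [FiniteDimensional ℂ V] [Nontrivial V] (S : Subalgebra ℂ (Module.End ℂ V))
    (h : ∀ U : Submodule ℂ V, (∀ a ∈ S, ∀ u ∈ U, a u ∈ U) → U = ⊥ ∨ U = ⊤) : S = ⊤ := by
  classical
  have hsimple : ∀ U : Submodule S V, U = ⊥ ∨ U = ⊤ := fun U => by
    rcases h (U.restrictScalars ℂ) (fun a ha u hu => U.smul_mem ⟨a, ha⟩ hu) with h | h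
    · exact Or.inl ((Submodule.restrictScalars_eq_bot_iff _ _ _).1 h)
    · exact Or.inr ((Submodule.restrictScalars_eq_top_iff _ _ _).1 h)
  have : IsSimpleModule S V := { eq_bot_or_eq_top := hsimple }
  have hscalar : ∀ f : Module.End S V, ∃ c : ℂ, ∀ v, f v = c • v := fun f => by
    obtain ⟨c, hc⟩ := Module.End.exists_eigenvalue (f.restrictScalars ℂ)
    obtain ⟨v, hv⟩ := hc.exists_hasEigenvector
    refine ⟨c, fun w => ?_⟩
    have hker : LinearMap.ker (f - c • (1 : Module.End S V)) = ⊤ := by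
      refine (hsimple _).resolve_left fun hbot => hv.2 ?_
      have : v ∈ LinearMap.ker (f - c • (1 : Module.End S V)) := by
        simpa [sub_eq_zero] using hv.apply_eq_smul
      simpa [hbot] using this
    have : w ∈ LinearMap.ker (f - c • (1 : Module.End S V)) := hker ▸ Submodule.mem_top
    simpa [sub_eq_zero] using this
  refine eq_top_iff.2 fun g _ => ?_
  let g' : Module.End (Module.End S V) V :=
    { toFun := g
      map_add' := g.map_add
      map_smul' := fun f v => by
        obtain ⟨c, hc⟩ := hscalar f
        simp [hc] }
  let b := Module.finBasis ℂ V
  obtain ⟨r, hr⟩ := jacobson_density g' (Finset.univ.image b)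
  have : g = r := b.ext fun i => hr (b i) (by simp)
  exact this ▸ r.2

/-- A linear pencil `f - c • g` with `g` injective is singular for some `c`. -/
theorem exists_apply_eq_smul_apply {V : Type*} [AddCommGroup V] [Module ℂ V]
    [FiniteDimensional ℂ V] [Nontrivial V] (f g : Module.End ℂ V) (hg : Function.Injective g) :
    ∃ (c : ℂ) (v : V), v ≠ 0 ∧ f v = c • g v := by
  let e := LinearEquiv.ofInjectiveEndo g hg
  obtain ⟨c, hc⟩ := Module.End.exists_eigenvalue (e.symm.toLinearMap ∘ₗ f)
  obtain ⟨v, hv⟩ := hc.exists_hasEigenvector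
  refine ⟨c, v, hv.2, ?_⟩
  have := congrArg e hv.apply_eq_smul
  simpa [e] using this

/-- An endomorphism `N` with `tr (N Z) = 0` for all `Z` vanishes. -/
theorem eq_zero_of_forall_trace_mul_eq_zero {V : Type*} [AddCommGroup V] [Module ℂ V]
    [FiniteDimensional ℂ V] (N : Module.End ℂ V)
    (h : ∀ Z : Module.End ℂ V, LinearMap.trace ℂ V (N * Z) = 0) : N = 0 := by
  ext v
  refine (Module.forall_dual_apply_eq_zero_iff ℂ _).1 fun φ => ?_
  have : N * φ.smulRight v = φ.smulRight (N v) := by ext; simp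
  simpa [this] using h (φ.smulRight v)

/-- The algebra of endomorphisms is simple: a subspace containing all products `Y X Z` for a fixed
`X ≠ 0` is everything. -/
theorem eq_top_of_forall_mul_mul_mem {V : Type*} [AddCommGroup V] [Module ℂ V]
    [FiniteDimensional ℂ V] {X : Module.End ℂ V} (hX : X ≠ 0)
    (W : Submodule ℂ (Module.End ℂ V)) (hW : ∀ Y Z, Y * X * Z ∈ W) : W = ⊤ := by
  obtain ⟨v, hv⟩ : ∃ v, X v ≠ 0 := by
    by_contra! h
    exact hX (LinearMap.ext h)
  obtain ⟨φ, hφ⟩ := Module.Projective.exists_dual_ne_zero ℂ hv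
  let b := Module.finBasis ℂ V
  refine eq_top_iff.2 fun T _ => ?_
  have hT : T = ∑ i, ((φ (X v))⁻¹ • φ.smulRight (T (b i))) * X * (b.coord i).smulRight v := by
    ext w
    conv_lhs => rw [← b.sum_repr w]
    rw [map_sum, LinearMap.sum_apply]
    refine Finset.sum_congr rfl fun i _ => ?_
    simp only [map_smul, Module.End.mul_apply, LinearMap.smulRight_apply, LinearMap.smul_apply,
      Module.Basis.coord_apply, smul_smul]
    rw [inv_mul_cancel₀ hφ, mul_one]
  rw [hT]
  exact W.sum_mem fun i _ => hW _ _

/-- A graded family of subspaces of endomorphisms for which all the arithmetic progressions of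
degrees `m, 2 * m, …` span contains a nonzero homogeneous idempotent, namely a multiple of any
non-nilpotent homogeneous element of minimal rank. -/
theorem exists_homogeneous_idempotent {V : Type*} [AddCommGroup V] [Module ℂ V]
    [FiniteDimensional ℂ V] [Nontrivial V] (S : ℕ → Submodule ℂ (Module.End ℂ V))
    (hmul : ∀ m n, ∀ a ∈ S m, ∀ b ∈ S n, a * b ∈ S (m + n))
    (htop : ∀ m, 1 ≤ m → ⨆ k, S ((k + 1) * m) = ⊤) :
    ∃ m, 1 ≤ m ∧ ∃ X ∈ S m, X ≠ 0 ∧ X * X = X := by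
  classical
  have trace_eq_zero : ∀ m, 1 ≤ m → ∀ N : Module.End ℂ V,
      (∀ k, ∀ Z ∈ S ((k + 1) * m), IsNilpotent (N * Z)) → N = 0 := fun m hm N hN => by
    refine eq_zero_of_forall_trace_mul_eq_zero N fun Z => ?_
    have hZ : Z ∈ ⨆ k, S ((k + 1) * m) := htop m hm ▸ Submodule.mem_top
    induction hZ using Submodule.iSup_induction' with
    | mem k Z hZ => exact (LinearMap.isNilpotent_trace_of_isNilpotent (hN k Z hZ)).eq_zero
    | zero => simp
    | add Y Z _ _ hY hZ => simp [mul_add, hY, hZ]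
  let P : ℕ → Prop := fun r => ∃ m, 1 ≤ m ∧ ∃ X ∈ S m, ¬ IsNilpotent X ∧
    Module.finrank ℂ (LinearMap.range X) = r
  have hP : ∃ r, P r := by
    by_contra! hcon
    refine one_ne_zero (trace_eq_zero 1 le_rfl 1 fun k Z hZ => ?_)
    by_contra hnil
    exact hcon _ ⟨(k + 1) * 1, by omega, Z, hZ, by simpa using hnil, rfl⟩
  obtain ⟨m, hm, X, hXS, hXn, hXr⟩ := Nat.find_spec hP
  have hmin : ∀ n, 1 ≤ n → ∀ Y ∈ S n,
      Module.finrank ℂ (LinearMap.range Y) < Module.finrank ℂ (LinearMap.range X) →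
      IsNilpotent Y := fun n hn Y hY hlt => by
    by_contra hYn
    exact Nat.find_min hP (hXr ▸ hlt) ⟨n, hn, Y, hY, hYn, rfl⟩
  have hpow : ∀ k, X ^ (k + 1) ∈ S ((k + 1) * m) := fun k => by
    induction k with
    | zero => simpa using hXS
    | succ k ih => rw [pow_succ, add_mul (k + 1), one_mul]; exact hmul _ _ _ ih _ hXS
  let R := LinearMap.range X
  have hXR : ∀ T : Module.End ℂ V, ∀ v ∈ R, (X * T) v ∈ R := fun T v _ => ⟨T v, rfl⟩
  have hRnt : Nontrivial R := by
    rw [Submodule.nontrivial_iff_ne_bot]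
    intro h
    exact hXn (LinearMap.range_eq_bot.1 h ▸ IsNilpotent.zero)
  have hrank : ∀ n, 1 ≤ n → ∀ T Z : Module.End ℂ V, T * X * Z ∈ S n →
      ∀ v ∈ R, v ≠ 0 → T v = 0 → IsNilpotent (T * X * Z) := fun n hn T Z hTZ v hv hv0 hTv => by
    refine hmin n hn _ hTZ ?_
    have hle : LinearMap.range (T * X * Z) ≤ LinearMap.range (T.domRestrict R) := by
      rintro _ ⟨w, rfl⟩
      exact ⟨⟨X (Z w), Z w, rfl⟩, rfl⟩
    have hker : 0 < Module.finrank ℂ (LinearMap.ker (T.domRestrict R)) := by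
      rw [Module.finrank_pos_iff, Submodule.nontrivial_iff_ne_bot, Submodule.ne_bot_iff]
      exact ⟨⟨v, hv⟩, hTv, fun h => hv0 (congrArg Subtype.val h)⟩
    have hsum := LinearMap.finrank_range_add_finrank_ker (T.domRestrict R)
    have := Submodule.finrank_mono hle
    change _ < Module.finrank ℂ R
    omega
  have hinj : ∀ v ∈ R, X v = 0 → v = 0 := fun v hv hXv => by
    by_contra hv0
    have hnil := hrank (m + m) (by omega) X 1 (by simpa using hmul _ _ _ hXS _ hXS) v hv hv0 hXv
    rw [mul_one, ← sq] at hnil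
    exact hXn (hnil.of_pow)
  have hpowR : ∀ k, ∀ v ∈ R, (X ^ (k + 1)) v ∈ R := fun k v _ => by
    rw [pow_succ']
    exact ⟨_, rfl⟩
  have hpowinj : ∀ k, ∀ v ∈ R, (X ^ (k + 1)) v = 0 → v = 0 := fun k => by
    induction k with
    | zero => simpa using hinj
    | succ k ih =>
      intro v hv h
      rw [pow_succ'] at h
      exact ih v hv (hinj _ (hpowR k v hv) h)
  obtain ⟨c, v, hv0, hXv⟩ : ∃ (c : ℂ) (v : V), v ≠ 0 ∧ (v ∈ R ∧ X v = c • v) := by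
    obtain ⟨c, v, hv0, h⟩ := exists_apply_eq_smul_apply (X.restrict fun w _ => ⟨w, rfl⟩ :
      Module.End ℂ R) 1 Function.injective_id
    exact ⟨c, v, by simpa using hv0, v.2, congrArg Subtype.val h⟩
  obtain ⟨hvR, hXv⟩ := hXv
  have hc : c ≠ 0 := fun h => hv0 (hinj v hvR (by simp [hXv, h]))
  have hXpow : ∀ k, (X ^ k) v = c ^ k • v := fun k => by
    induction k with
    | zero => simp
    | succ k ih => rw [pow_succ', Module.End.mul_apply, ih, map_smul, hXv, smul_smul, pow_succ]
  have hline : ∀ k, ∀ Y ∈ S ((k + 1) * m), ∃ a : ℂ, X (Y v) = a • v := fun k Y hY => by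
    have hg : Function.Injective ((X ^ (k + 2)).restrict (hpowR (k + 1)) : Module.End ℂ R) := by
      rw [← LinearMap.ker_eq_bot, LinearMap.ker_eq_bot']
      exact fun w hw => Subtype.ext (hpowinj (k + 1) w w.2 (congrArg Subtype.val hw))
    obtain ⟨a, w, hw0, hw⟩ := exists_apply_eq_smul_apply ((X * Y).restrict (hXR Y) :
      Module.End ℂ R) _ hg
    have hw' : (X * Y - a • X ^ (k + 2)) w = 0 := by
      simpa [sub_eq_zero] using congrArg Subtype.val hw
    have hTS : X * Y - a • X ^ (k + 2) ∈ S ((k + 2) * m) := by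
      refine Submodule.sub_mem _ ?_ (Submodule.smul_mem _ _ (hpow (k + 1)))
      have := hmul _ _ _ hXS _ hY
      rwa [show m + (k + 1) * m = (k + 2) * m by ring] at this
    have hTX := trace_eq_zero m hm ((X * Y - a • X ^ (k + 2)) * X) fun j Z hZ =>
      hrank ((k + 2) * m + m + (j + 1) * m) (by omega) _ Z
        (hmul _ _ _ (hmul _ _ _ hTS _ hXS) _ hZ) w w.2 (by simpa using hw0) hw'
    have hTv := LinearMap.congr_fun hTX v
    rw [Module.End.mul_apply, hXv, map_smul, LinearMap.zero_apply, smul_eq_zero_iff_right hc,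
      LinearMap.sub_apply, sub_eq_zero, LinearMap.smul_apply, hXpow, smul_smul] at hTv
    exact ⟨_, hTv⟩
  have hline' : ∀ Y : Module.End ℂ V, ∃ a : ℂ, X (Y v) = a • v := fun Y => by
    have hY : Y ∈ ⨆ k, S ((k + 1) * m) := htop m hm ▸ Submodule.mem_top
    induction hY using Submodule.iSup_induction' with
    | mem k Y hY => exact hline k Y hY
    | zero => exact ⟨0, by simp⟩
    | add Y Z _ _ hY hZ =>
      obtain ⟨a, ha⟩ := hY
      obtain ⟨b, hb⟩ := hZ
      exact ⟨a + b, by simp [ha, hb, add_smul]⟩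
  have hXX : X * X = c • X := by
    ext w
    obtain ⟨φ, hφ⟩ := Module.Projective.exists_dual_ne_zero ℂ hv0
    obtain ⟨a, ha⟩ := hline' ((φ v)⁻¹ • φ.smulRight w)
    have hw : X w = a • v := by simpa [hφ] using ha
    simp [hw, hXv, smul_comm c a]
  refine ⟨m, hm, c⁻¹ • X, Submodule.smul_mem _ _ hXS, smul_ne_zero (inv_ne_zero hc) ?_, ?_⟩
  · rintro rfl
    exact hXn IsNilpotent.zero
  · rw [smul_mul_smul_comm, hXX, smul_smul, inv_mul_cancel_right₀ hc]

/-- In a graded family of subspaces of endomorphisms for which all the arithmetic progressions of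
degrees `m, 2 * m, …` span, some homogeneous component is already everything. -/
theorem exists_eq_top_of_forall_iSup_eq_top {V : Type*} [AddCommGroup V] [Module ℂ V]
    [FiniteDimensional ℂ V] [Nontrivial V] (S : ℕ → Submodule ℂ (Module.End ℂ V))
    (hmul : ∀ m n, ∀ a ∈ S m, ∀ b ∈ S n, a * b ∈ S (m + n))
    (htop : ∀ m, 1 ≤ m → ⨆ k, S ((k + 1) * m) = ⊤) : ∃ n, 1 ≤ n ∧ S n = ⊤ := by
  obtain ⟨m, hm, X, hX, hX0, hXX⟩ := exists_homogeneous_idempotent S hmul htop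
  have hXpow : ∀ i, X ∈ S ((i + 1) * m) := fun i => by
    induction i with
    | zero => simpa using hX
    | succ i ih => rw [← hXX, add_mul (i + 1), one_mul]; exact hmul _ _ _ ih _ hX
  let W : Submodule ℂ (Module.End ℂ V) :=
    { carrier := {Z | ∃ N, ∀ n, N ≤ n → Z ∈ S (n * m)}
      zero_mem' := ⟨0, fun n _ => Submodule.zero_mem _⟩
      add_mem' := by
        rintro Y Z ⟨M, hM⟩ ⟨N, hN⟩
        exact ⟨max M N, fun n hn => Submodule.add_mem _ (hM n (le_trans (le_max_left _ _) hn))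
          (hN n (le_trans (le_max_right _ _) hn))⟩
      smul_mem' := by
        rintro c Z ⟨N, hN⟩
        exact ⟨N, fun n hn => Submodule.smul_mem _ _ (hN n hn)⟩ }
  have hW : ∀ Y Z : Module.End ℂ V, Y * X * Z ∈ W := fun Y Z => by
    have hY : Y ∈ ⨆ k, S ((k + 1) * m) := htop m hm ▸ Submodule.mem_top
    have hZ : Z ∈ ⨆ k, S ((k + 1) * m) := htop m hm ▸ Submodule.mem_top
    induction hY using Submodule.iSup_induction' with
    | zero => simp
    | add Y Y' _ _ hY hY' => simpa only [add_mul] using W.add_mem hY hY'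
    | mem k Y hY =>
      induction hZ using Submodule.iSup_induction' with
      | zero => simp
      | add Z Z' _ _ hZ hZ' => simpa only [mul_add] using W.add_mem hZ hZ'
      | mem j Z hZ =>
        refine ⟨k + j + 3, fun n hn => ?_⟩
        obtain ⟨i, rfl⟩ := Nat.exists_eq_add_of_le hn
        have := hmul _ _ _ (hmul _ _ _ hY _ (hXpow i)) _ hZ
        rwa [show (k + 1) * m + (i + 1) * m + (j + 1) * m = (k + j + 3 + i) * m by ring] at this
  have hWtop := eq_top_of_forall_mul_mul_mem hX0 W hW
  obtain ⟨s, hs⟩ := Module.Finite.fg_top (R := ℂ) (M := Module.End ℂ V)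
  have hbound : ∀ Z : Module.End ℂ V, ∃ N, ∀ n, N ≤ n → Z ∈ S (n * m) := fun Z =>
    (hWtop ▸ Submodule.mem_top : Z ∈ W)
  choose N hN using hbound
  refine ⟨(s.sup N + 1) * m, Nat.mul_pos (by omega) hm, ?_⟩
  rw [eq_top_iff, ← hs, Submodule.span_le]
  exact fun Z hZ => hN Z _ (le_trans (Finset.le_sup hZ) (by omega))

/-- `B` is multiplicative on the words whose length is divisible by `K`; its values on other words
are irrelevant. -/
structure IsBlockRep {ι V : Type*} [AddCommGroup V] [Module ℂ V] (K : ℕ)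
    (B : List ι → Module.End ℂ V) : Prop where
  map_nil : B [] = 1
  map_append : ∀ u v : List ι, K ∣ u.length → K ∣ v.length → B (u ++ v) = B u * B v

/-- The span of the values of `B` on words of length `n`. -/
def wordSpan {ι V : Type*} [AddCommGroup V] [Module ℂ V] (B : List ι → Module.End ℂ V) (n : ℕ) :
    Submodule ℂ (Module.End ℂ V) :=
  Submodule.span ℂ (B '' {w | w.length = n})

/-- The words consisting of `n` blocks of length `K` span all endomorphisms, for some `n`. -/
def IsFull {ι V : Type*} [AddCommGroup V] [Module ℂ V] (K : ℕ) (B : List ι → Module.End ℂ V) :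
    Prop :=
  ∃ n, 1 ≤ n ∧ wordSpan B (n * K) = ⊤

theorem IsBlockRep.of_dvd {ι V : Type*} [AddCommGroup V] [Module ℂ V] {K K' : ℕ}
    {B : List ι → Module.End ℂ V} (hB : IsBlockRep K B) (h : K ∣ K') : IsBlockRep K' B :=
  ⟨hB.map_nil, fun u v hu hv => hB.map_append u v (h.trans hu) (h.trans hv)⟩

theorem IsBlockRep.mul_mem_wordSpan {ι V : Type*} [AddCommGroup V] [Module ℂ V] {K : ℕ}
    {B : List ι → Module.End ℂ V} (hB : IsBlockRep K B) (m n : ℕ) (a : Module.End ℂ V)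
    (ha : a ∈ wordSpan B (m * K)) (b : Module.End ℂ V) (hb : b ∈ wordSpan B (n * K)) :
    a * b ∈ wordSpan B ((m + n) * K) := by
  have := Submodule.mul_mem_mul ha hb
  rw [wordSpan, wordSpan, Submodule.span_mul_span] at this
  refine Submodule.span_mono ?_ this
  rintro _ ⟨_, ⟨u, hu, rfl⟩, _, ⟨v, hv, rfl⟩, rfl⟩
  refine ⟨u ++ v, ?_, hB.map_append u v (hu ▸ dvd_mul_left _ _) (hv ▸ dvd_mul_left _ _)⟩
  simp only [Set.mem_ofPred_eq] at hu hv ⊢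
  rw [List.length_append, hu, hv, add_mul]

theorem IsFull.of_mul {ι V : Type*} [AddCommGroup V] [Module ℂ V] {K : ℕ}
    {B : List ι → Module.End ℂ V} (hfull : IsFull K B) (hB : IsBlockRep K B) {c : ℕ}
    (hc : 1 ≤ c) : IsFull (c * K) B := by
  obtain ⟨n, hn, htop⟩ := hfull
  refine ⟨n, hn, ?_⟩
  obtain ⟨c, rfl⟩ := Nat.exists_eq_add_of_le hc
  rw [← mul_assoc]
  clear hc
  induction c with
  | zero => simpa using htop
  | succ c ih =>
    refine eq_top_iff.2 fun a _ => ?_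
    have := hB.mul_mem_wordSpan (n * (1 + c)) n a (ih ▸ Submodule.mem_top) 1
      (htop ▸ Submodule.mem_top)
    rwa [mul_one, show n * (1 + c) + n = n * (1 + (c + 1)) by ring] at this

/-- For an irreducible block representation, the nonempty words either act as zero or span all
endomorphisms. -/
theorem IsBlockRep.iSup_wordSpan_eq_top {ι V : Type*} [AddCommGroup V] [Module ℂ V]
    [FiniteDimensional ℂ V] [Nontrivial V] {K : ℕ} {B : List ι → Module.End ℂ V}
    (hB : IsBlockRep K B)
    (hirr : ∀ U : Submodule ℂ V, (∀ w, K ∣ w.length → ∀ u ∈ U, B w u ∈ U) → U = ⊥ ∨ U = ⊤)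
    {w₀ : List ι} (hw₀ : w₀ ≠ []) (hdvd : K ∣ w₀.length) (hne : B w₀ ≠ 0) :
    ⨆ k, wordSpan B ((k + 1) * K) = ⊤ := by
  let T : Submonoid (Module.End ℂ V) :=
    { carrier := B '' {w | K ∣ w.length}
      one_mem' := ⟨[], by simp, hB.map_nil⟩
      mul_mem' := by
        rintro _ _ ⟨u, hu, rfl⟩ ⟨v, hv, rfl⟩
        exact ⟨u ++ v, by simpa using dvd_add hu hv, hB.map_append u v hu hv⟩ }
  have hadjoin : Algebra.adjoin ℂ (T : Set (Module.End ℂ V)) = ⊤ :=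
    eq_top_of_forall_invariant _ fun U hU =>
      hirr U fun w hw u hu => hU _ (Algebra.subset_adjoin ⟨w, hw, rfl⟩) u hu
  have hspan : Submodule.span ℂ (T : Set (Module.End ℂ V)) = ⊤ := by
    have := Algebra.adjoin_eq_span ℂ (T : Set (Module.End ℂ V))
    rw [hadjoin, Submonoid.closure_eq, Algebra.top_toSubmodule] at this
    exact this.symm
  refine eq_top_of_forall_mul_mul_mem hne _ fun Y Z => ?_
  have hY : Y ∈ Submodule.span ℂ (T : Set (Module.End ℂ V)) := hspan ▸ Submodule.mem_top
  have hZ : Z ∈ Submodule.span ℂ (T : Set (Module.End ℂ V)) := hspan ▸ Submodule.mem_top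
  induction hY using Submodule.span_induction with
  | zero => simp
  | add Y Y' _ _ hY hY' => simpa only [add_mul] using Submodule.add_mem _ hY hY'
  | smul c Y _ hY => simpa only [smul_mul_assoc] using Submodule.smul_mem _ c hY
  | mem Y hY =>
    obtain ⟨u, hu, rfl⟩ := hY
    induction hZ using Submodule.span_induction with
    | zero => simp
    | add Z Z' _ _ hZ hZ' => simpa only [mul_add] using Submodule.add_mem _ hZ hZ'
    | smul c Z _ hZ => simpa only [mul_smul_comm] using Submodule.smul_mem _ c hZ
    | mem Z hZ =>
      obtain ⟨v, hv, rfl⟩ := hZ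
      have huw : K ∣ (u ++ w₀).length := by simpa using dvd_add hu hdvd
      rw [← hB.map_append _ _ hu hdvd, ← hB.map_append _ _ huw hv]
      have hlen : K ∣ (u ++ w₀ ++ v).length := by
        rw [List.length_append]
        exact dvd_add huw hv
      obtain ⟨k, hk⟩ := hlen
      have hpos : 0 < (u ++ w₀ ++ v).length := by
        have := List.length_pos_iff.2 hw₀
        simp only [List.length_append]
        omega
      obtain ⟨k, rfl⟩ : ∃ j, k = j + 1 := Nat.exists_eq_succ_of_ne_zero fun h => by simp_all
      exact Submodule.mem_iSup_of_mem k
        (Submodule.subset_span ⟨_, by rw [Set.mem_ofPred, hk, mul_comm], rfl⟩)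

/-- A nontrivial subspace `U` of `ℂ^D` splits `ℂ^D` into two smaller coordinate spaces. -/
theorem exists_splitting {D : ℕ} (U : Submodule ℂ (Fin D → ℂ)) (hbot : U ≠ ⊥) (htop : U ≠ ⊤) :
    ∃ a b, a < D ∧ b < D ∧
      ∃ (P : (Fin D → ℂ) →ₗ[ℂ] (Fin a → ℂ)) (J : (Fin a → ℂ) →ₗ[ℂ] (Fin D → ℂ))
        (P' : (Fin D → ℂ) →ₗ[ℂ] (Fin b → ℂ)) (J' : (Fin b → ℂ) →ₗ[ℂ] (Fin D → ℂ)),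
        (∀ x, P (J x) = x) ∧ (∀ x, P' (J' x) = x) ∧ (∀ x, J (P x) + J' (P' x) = x) ∧
        (∀ x, J x ∈ U) ∧ ∀ u ∈ U, P' u = 0 := by
  obtain ⟨U', hU'⟩ := exists_isCompl U
  have hsum := Submodule.finrank_add_eq_of_isCompl hU'
  have hlt := Submodule.finrank_lt htop
  have hpos : 0 < Module.finrank ℂ U := by
    rwa [Module.finrank_pos_iff, Submodule.nontrivial_iff_ne_bot]
  rw [Module.finrank_fin_fun] at hsum hlt
  let q := Submodule.prodEquivOfIsCompl U U' hU'
  let e := (Module.finBasis ℂ U).equivFun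
  let e' := (Module.finBasis ℂ U').equivFun
  refine ⟨_, _, hlt, by omega,
    e.toLinearMap ∘ₗ LinearMap.fst ℂ U U' ∘ₗ q.symm.toLinearMap,
    U.subtype ∘ₗ e.symm.toLinearMap,
    e'.toLinearMap ∘ₗ LinearMap.snd ℂ U U' ∘ₗ q.symm.toLinearMap,
    U'.subtype ∘ₗ e'.symm.toLinearMap, fun x => ?_, fun x => ?_, fun x => ?_, fun x => ?_,
    fun u hu => ?_⟩
  · simp [q]
  · simp [q]
  · simpa [q] using q.apply_symm_apply x
  · simp
  · simpa [q] using hu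

/-- **Canonical decomposition of block representations**: after passing to longer blocks, the
trace of a block representation is a sum of traces of full block representations. -/
theorem IsBlockRep.exists_full_decomposition {ι : Type*} {D K : ℕ} (hK : 1 ≤ K)
    {B : List ι → Module.End ℂ (Fin D → ℂ)} (hB : IsBlockRep K B) :
    ∃ m, 1 ≤ m ∧ ∃ F : List (Σ D' : ℕ, List ι → Module.End ℂ (Fin D' → ℂ)),
      (∀ p ∈ F, IsBlockRep (m * K) p.2 ∧ IsFull (m * K) p.2) ∧
      ∀ w : List ι, w ≠ [] → m * K ∣ w.length →
        LinearMap.trace ℂ _ (B w) = (F.map fun p => LinearMap.trace ℂ _ (p.2 w)).sum := by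
  induction D using Nat.strong_induction_on generalizing K with
  | _ D ih =>
  rcases Nat.eq_zero_or_pos D with rfl | hD
  · exact ⟨1, le_rfl, [], by simp, fun w _ _ => by simp [Subsingleton.elim (B w) 0]⟩
  have : Nonempty (Fin D) := ⟨⟨0, hD⟩⟩
  by_cases hirr : ∀ m, 1 ≤ m → ∀ U : Submodule ℂ (Fin D → ℂ),
      (∀ w, m * K ∣ w.length → ∀ u ∈ U, B w u ∈ U) → U = ⊥ ∨ U = ⊤
  · by_cases hzero : ∃ m, 1 ≤ m ∧ ∀ w : List ι, w ≠ [] → m * K ∣ w.length → B w = 0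
    · obtain ⟨m, hm, hzero⟩ := hzero
      exact ⟨m, hm, [], by simp, fun w hw hwK => by simp [hzero w hw hwK]⟩
    · refine ⟨1, le_rfl, [⟨D, B⟩], ?_, by simp⟩
      simp only [List.mem_singleton, forall_eq, one_mul]
      refine ⟨hB, exists_eq_top_of_forall_iSup_eq_top (fun n => wordSpan B (n * K))
        hB.mul_mem_wordSpan fun m hm => ?_⟩
      push Not at hzero
      obtain ⟨w, hw, hdvd, hne⟩ := hzero m hm
      simpa only [mul_assoc] using
        (hB.of_dvd (dvd_mul_left K m)).iSup_wordSpan_eq_top (hirr m hm) hw hdvd hne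
  · push Not at hirr
    obtain ⟨m, hm, U, hU, hbot, htop⟩ := hirr
    obtain ⟨a, b, ha, hb, P, J, P', J', hPJ, hPJ', hsum, hJU, hPU⟩ := exists_splitting U hbot htop
    have hmK : 1 ≤ m * K := Nat.mul_pos hm hK
    have hBm := hB.of_dvd (dvd_mul_left K m)
    have hsplit : ∀ w x, B w x = B w (J (P x)) + B w (J' (P' x)) := fun w x => by
      rw [← map_add, hsum]
    have hzero : ∀ w, m * K ∣ w.length → ∀ x, P' (B w (J x)) = 0 := fun w hw x =>
      hPU _ (hU w hw _ (hJU x))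
    have hB₁ : IsBlockRep (m * K) fun w => P ∘ₗ B w ∘ₗ J :=
      ⟨LinearMap.ext fun x => by simp [hB.map_nil, hPJ], fun u v hu hv => LinearMap.ext fun x => by
        simp [hBm.map_append u v hu hv, hsplit u (B v (J x)), hzero v hv]⟩
    have hB₂ : IsBlockRep (m * K) fun w => P' ∘ₗ B w ∘ₗ J' :=
      ⟨LinearMap.ext fun x => by simp [hB.map_nil, hPJ'], fun u v hu hv => LinearMap.ext fun x => by
        simp [hBm.map_append u v hu hv, hsplit u (B v (J' x)), hzero u hu]⟩
    obtain ⟨m₁, hm₁, F₁, hF₁, htr₁⟩ := ih a ha hmK hB₁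
    obtain ⟨m₂, hm₂, F₂, hF₂, htr₂⟩ := ih b hb hmK hB₂
    have hd₁ : m₁ * m₂ * m * K = m₂ * (m₁ * (m * K)) := by ring
    have hd₂ : m₁ * m₂ * m * K = m₁ * (m₂ * (m * K)) := by ring
    refine ⟨m₁ * m₂ * m, Nat.mul_pos (Nat.mul_pos hm₁ hm₂) hm, F₁ ++ F₂, fun p hp => ?_,
      fun w hw hdvd => ?_⟩
    · rcases List.mem_append.1 hp with hp | hp
      · obtain ⟨hrep, hfull⟩ := hF₁ p hp
        rw [hd₁]
        exact ⟨hrep.of_dvd (dvd_mul_left _ _), hfull.of_mul hrep hm₂⟩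
      · obtain ⟨hrep, hfull⟩ := hF₂ p hp
        rw [hd₂]
        exact ⟨hrep.of_dvd (dvd_mul_left _ _), hfull.of_mul hrep hm₁⟩
    · rw [List.map_append, List.sum_append, ← htr₁ w hw ((Dvd.intro_left _ hd₁.symm).trans hdvd),
        ← htr₂ w hw ((Dvd.intro_left _ hd₂.symm).trans hdvd),
        LinearMap.trace_comp_comm', LinearMap.trace_comp_comm' _ P', ← map_add]
      congr 1
      refine LinearMap.ext fun x => ?_
      simp only [LinearMap.add_apply, LinearMap.comp_apply]
      rw [← map_add, hsum]

/-- Vectors annihilated by an iterate of the transfer map, applied to `ρ`, are mapped into the kernel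
of `ρ` by the adjoints of all words of the corresponding length. -/
theorem posSemidef_iterate_transferMap {D : ℕ} {κ : Type*} [Fintype κ]
    (A : κ → Matrix (Fin D) (Fin D) ℂ) {ρ : Matrix (Fin D) (Fin D) ℂ} (hρ : ρ.PosSemidef) (n : ℕ) :
    ((transferMap A)^[n] ρ).PosSemidef ∧
      ∀ v, star v ⬝ᵥ ((transferMap A)^[n] ρ *ᵥ v) = 0 →
        ∀ l : List κ, l.length = n → ρ *ᵥ ((l.map A).prodᴴ *ᵥ v) = 0 := by
  induction n with
  | zero =>
    refine ⟨hρ, fun v hv l hl => ?_⟩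
    rw [List.length_eq_zero_iff.1 hl]
    simpa using (hρ.dotProduct_mulVec_zero_iff v).1 hv
  | succ n ih =>
    obtain ⟨hpsd, hker⟩ := ih
    have hterm : ∀ k, (A k * (transferMap A)^[n] ρ * (A k)ᴴ).PosSemidef := fun k =>
      hpsd.mul_mul_conjTranspose_same (A k)
    rw [Function.iterate_succ_apply', transferMap]
    refine ⟨Matrix.posSemidef_sum _ fun k _ => hterm k, fun v hv l hl => ?_⟩
    rw [Matrix.sum_mulVec, dotProduct_sum,
      Finset.sum_eq_zero_iff_of_nonneg fun k _ => (hterm k).dotProduct_mulVec_nonneg v] at hv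
    obtain ⟨k, l, rfl⟩ := List.exists_cons_of_length_eq_add_one hl
    have hk := hv k (Finset.mem_univ k)
    rw [← Matrix.mulVec_mulVec, ← Matrix.mulVec_mulVec, Matrix.dotProduct_mulVec,
      ← Matrix.conjTranspose_conjTranspose (A k), ← Matrix.star_mulVec,
      Matrix.conjTranspose_conjTranspose] at hk
    rw [List.map_cons, List.prod_cons, Matrix.conjTranspose_mul, ← Matrix.mulVec_mulVec]
    exact hker _ hk l (by simpa using hl)

/-- A tensor is normal as soon as the words of some length span the full matrix algebra. -/
theorem isPrimitive_of_span_eq_top {D : ℕ} {κ : Type*} [Fintype κ]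
    (A : κ → Matrix (Fin D) (Fin D) ℂ) {n : ℕ} (hn : 1 ≤ n)
    (hspan : Submodule.span ℂ ((fun l : List κ => (l.map A).prod) '' {l | l.length = n}) = ⊤) :
    IsPrimitive A := by
  refine ⟨n, hn, fun ρ hρ hρ0 => ?_⟩
  obtain ⟨hpsd, hker⟩ := posSemidef_iterate_transferMap A hρ n
  refine Matrix.PosDef.of_dotProduct_mulVec_pos hpsd.isHermitian fun v hv =>
    lt_of_le_of_ne (hpsd.dotProduct_mulVec_nonneg v) fun h => hρ0 ?_
  have hall : ∀ X : Matrix (Fin D) (Fin D) ℂ, ρ *ᵥ (Xᴴ *ᵥ v) = 0 := fun X => by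
    have hX : X ∈ Submodule.span ℂ
        ((fun l : List κ => (l.map A).prod) '' {l | l.length = n}) := hspan ▸ Submodule.mem_top
    induction hX using Submodule.span_induction with
    | mem X hX =>
      obtain ⟨l, hl, rfl⟩ := hX
      exact hker v h.symm l hl
    | zero => simp
    | add X Y _ _ hX hY => simp [Matrix.add_mulVec, Matrix.mulVec_add, hX, hY]
    | smul c X _ hX => simp [Matrix.smul_mulVec, Matrix.mulVec_smul, hX]
  obtain ⟨j, hj⟩ := Function.ne_iff.1 hv
  ext i k
  have hsingle : (Matrix.single j k (star (v j)⁻¹))ᴴ *ᵥ v = Pi.single k 1 := by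
    rw [Matrix.conjTranspose_single, star_star, Matrix.single_mulVec, inv_mul_cancel₀ hj]
    rfl
  have := congrFun (hall (Matrix.single j k (star (v j)⁻¹))) i
  rw [hsingle] at this
  simpa using this

theorem dvd_length_flatten_map_ofFn {ι : Type*} {K : ℕ} (l : List (Fin K → ι)) :
    K ∣ (l.map List.ofFn).flatten.length := by
  induction l with
  | nil => simp
  | cons b l ih => simpa using ih

theorem IsBlockRep.prod_map_ofFn {ι V : Type*} [AddCommGroup V] [Module ℂ V] {K : ℕ}
    {B : List ι → Module.End ℂ V} (hB : IsBlockRep K B) (l : List (Fin K → ι)) :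
    (l.map fun b => B (List.ofFn b)).prod = B (l.map List.ofFn).flatten := by
  induction l with
  | nil => simp [hB.map_nil]
  | cons b l ih =>
    rw [List.map_cons, List.prod_cons, ih, List.map_cons, List.flatten_cons,
      hB.map_append _ _ (by simp) (dvd_length_flatten_map_ofFn l)]

theorem exists_flatten_map_ofFn_eq {ι : Type*} {K : ℕ} (n : ℕ) (w : List ι)
    (hw : w.length = n * K) :
    ∃ l : List (Fin K → ι), l.length = n ∧ (l.map List.ofFn).flatten = w := by
  induction n generalizing w with
  | zero => exact ⟨[], rfl, (List.length_eq_zero_iff.1 (by simpa using hw)).symm⟩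
  | succ n ih =>
    rw [add_mul, one_mul] at hw
    obtain ⟨l, hl, hlw⟩ := ih (w.drop K) (by simp [hw])
    refine ⟨(fun s => w[(s : ℕ)]) :: l, by simp [hl], ?_⟩
    rw [List.map_cons, List.flatten_cons, hlw]
    conv_rhs => rw [← List.take_append_drop K w]
    congr 1
    refine List.ext_getElem (by simp [hw]) fun i _ _ => by simp

/-- The tensor, with blocks of length `K` as physical index, of a block representation. -/
def blockTensor {ι : Type*} {D : ℕ} (K : ℕ) (B : List ι → Module.End ℂ (Fin D → ℂ)) :
    (Fin K → ι) → Matrix (Fin D) (Fin D) ℂ :=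
  fun b => LinearMap.toMatrixAlgEquiv' (B (List.ofFn b))

theorem IsBlockRep.prod_map_blockTensor {ι : Type*} {D K : ℕ}
    {B : List ι → Module.End ℂ (Fin D → ℂ)} (hB : IsBlockRep K B) (l : List (Fin K → ι)) :
    (l.map (blockTensor K B)).prod = LinearMap.toMatrixAlgEquiv' (B (l.map List.ofFn).flatten) := by
  rw [← hB.prod_map_ofFn, map_list_prod, List.map_map]
  rfl

theorem IsFull.isPrimitive_blockTensor {ι : Type*} [Fintype ι] {D K : ℕ}
    {B : List ι → Module.End ℂ (Fin D → ℂ)} (hB : IsBlockRep K B) (hfull : IsFull K B) :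
    IsPrimitive (blockTensor K B) := by
  classical
  obtain ⟨n, hn, htop⟩ := hfull
  refine isPrimitive_of_span_eq_top _ hn (eq_top_iff.2 ?_)
  let e := (LinearMap.toMatrixAlgEquiv' (R := ℂ) (n := Fin D))
  have hmap := congrArg (Submodule.map e.toLinearMap) htop
  have hrange : LinearMap.range e.toLinearMap = ⊤ := LinearMap.range_eq_top.2 e.surjective
  rw [wordSpan, Submodule.map_span, Submodule.map_top, hrange] at hmap
  rw [← hmap]
  refine Submodule.span_mono ?_
  rintro _ ⟨_, ⟨w, hw, rfl⟩, rfl⟩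
  obtain ⟨l, hl, rfl⟩ := exists_flatten_map_ofFn_eq n w hw
  exact ⟨l, hl, hB.prod_map_blockTensor l⟩

theorem trace_toMatrixAlgEquiv' {D : ℕ} (f : Module.End ℂ (Fin D → ℂ)) :
    (LinearMap.toMatrixAlgEquiv' f).trace = LinearMap.trace ℂ _ f := by
  rw [LinearMap.trace_eq_matrix_trace ℂ (Pi.basisFun ℂ (Fin D)), LinearMap.toMatrix_eq_toMatrix']
  rfl

theorem IsBlockRep.Vn_blockTensor {ι : Type*} {D K : ℕ}
    {B : List ι → Module.End ℂ (Fin D → ℂ)} (hB : IsBlockRep K B) {n : ℕ}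
    (i : Fin n → Fin K → ι) :
    Vn (blockTensor K B) n i =
      LinearMap.trace ℂ _ (B (List.ofFn fun t => List.ofFn (i t)).flatten) := by
  have := hB.prod_map_blockTensor (List.ofFn i)
  rw [List.map_ofFn, List.map_ofFn] at this
  rw [Vn, mpsProd, ← trace_toMatrixAlgEquiv']
  exact congrArg Matrix.trace this

/-- A finite sum of MPS vectors of normal tensors is a combination of the vectors of pairwise
essentially different ones. -/
theorem exists_essentiallyDifferent {κ : Type*} [Fintype κ] {I : Type*} [Fintype I] {D : I → ℕ}
    (F : ∀ x, κ → Matrix (Fin (D x)) (Fin (D x)) ℂ) (hF : ∀ x, IsPrimitive (F x)) :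
    ∃ (L : ℕ) (Dk : Fin L → ℕ) (B : ∀ k : Fin L, κ → Matrix (Fin (Dk k)) (Fin (Dk k)) ℂ)
      (M : Fin L → ℕ) (μ : ∀ k : Fin L, Fin (M k) → ℂ),
      (∀ k, IsPrimitive (B k)) ∧
      (∀ k l : Fin L, k ≠ l → EssentiallyDifferent (B k) (B l)) ∧
      ∀ n : ℕ, 1 ≤ n → ∀ i : Fin n → κ,
        ∑ x, Vn (F x) n i = ∑ k : Fin L, (∑ j : Fin (M k), μ k j ^ n) * Vn (B k) n i := by
  classical
  let J := {x : I // ∃ n, 1 ≤ n ∧ ∃ i, Vn (F x) n i ≠ 0}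
  let r : J → J → Prop := fun x y =>
    ∃ lam : ℂ, ∀ n, 1 ≤ n → ∀ i, Vn (F x.1) n i = lam ^ n * Vn (F y.1) n i
  let s : Setoid J :=
    { r := r
      iseqv :=
        { refl := fun x => ⟨1, by simp⟩
          symm := by
            rintro ⟨x, m, hm, j, hj⟩ y ⟨lam, h⟩
            have hlam : lam ≠ 0 := by
              rintro rfl
              exact hj (by rw [h m hm j, zero_pow (by omega), zero_mul])
            refine ⟨lam⁻¹, fun n hn i => ?_⟩
            rw [h n hn i, ← mul_assoc, ← mul_pow, inv_mul_cancel₀ hlam, one_pow, one_mul]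
          trans := by
            rintro x y z ⟨a, ha⟩ ⟨b, hb⟩
            exact ⟨a * b, fun n hn i => by rw [ha n hn i, hb n hn i, mul_pow, mul_assoc]⟩ } }
  have hrel : ∀ x : J, ∃ lam : ℂ, ∀ n, 1 ≤ n → ∀ i,
      Vn (F x.1) n i = lam ^ n * Vn (F (Quotient.mk s x).out.1) n i := fun x =>
    s.symm (Quotient.mk_out x)
  choose lam hlam using hrel
  let e : Quotient s ≃ Fin (Fintype.card (Quotient s)) := Fintype.equivFin _
  let f : ∀ q : Quotient s, {x : J // Quotient.mk s x = q} ≃ Fin _ := fun q => Fintype.equivFin _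
  refine ⟨_, fun k => D (e.symm k).out.1, fun k => F (e.symm k).out.1, fun k => _,
    fun k j => lam ((f (e.symm k)).symm j).1, fun k => hF _, fun k l hkl h => hkl ?_,
    fun n hn i => ?_⟩
  · have : (e.symm k).out ≈ (e.symm l).out := h
    exact e.symm.injective (Quotient.out_equiv_out.1 this)
  · have hJ : ∑ x, Vn (F x) n i = ∑ x : J, Vn (F x.1) n i := by
      rw [← Finset.sum_filter_of_ne (p := fun x => ∃ n, 1 ≤ n ∧ ∃ i, Vn (F x) n i ≠ 0)
        fun x _ hx => ⟨n, hn, i, hx⟩]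
      exact Finset.sum_subtype _ (by simp) _
    rw [hJ, ← Finset.sum_fiberwise Finset.univ (Quotient.mk s), ← e.symm.sum_comp]
    refine Finset.sum_congr rfl fun k _ => ?_
    rw [(f (e.symm k)).symm.sum_comp fun x => lam x.1 ^ n, Finset.sum_mul,
      Finset.sum_subtype (p := fun x => Quotient.mk s x = e.symm k) _ (by simp)]
    refine Finset.sum_congr rfl fun x _ => ?_
    obtain ⟨x, hx⟩ := x
    rw [hlam x n hn i, hx]

/-- **Canonical decomposition after blocking.**
For any MPS tensor `A` there is a blocking length `K ≥ 1`, pairwise essentially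
different normal tensors `B_1,…,B_L` with physical dimension `d^K` (their physical
index being a block of `K` indices of dimension `d`), and scalars `μ_{ij}` such that
`V_{Kn}(A) = ∑_i (∑_j μ_{ij}^n) V_n(B_i)` for all `n ≥ 1`, where `Kn` physical
indices are grouped into `n` consecutive blocks of `K`. -/
theorem blocked_canonical_decomposition {D d : ℕ}
    (A : Fin d → Matrix (Fin D) (Fin D) ℂ) :
    ∃ (K : ℕ), 1 ≤ K ∧
    ∃ (L : ℕ) (Dk : Fin L → ℕ)
      (B : ∀ k : Fin L, (Fin K → Fin d) → Matrix (Fin (Dk k)) (Fin (Dk k)) ℂ)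
      (M : Fin L → ℕ) (μ : ∀ k : Fin L, Fin (M k) → ℂ),
      (∀ k, IsPrimitive (B k)) ∧
      (∀ k l : Fin L, k ≠ l → EssentiallyDifferent (B k) (B l)) ∧
      ∀ n : ℕ, 1 ≤ n → ∀ i : Fin (K * n) → Fin d,
        Vn A (K * n) i =
          ∑ k : Fin L, (∑ j : Fin (M k), μ k j ^ n) *
            Vn (B k) n (fun t s => i ⟨(t : ℕ) * K + (s : ℕ), by
              have ht : (t : ℕ) < n := t.isLt
              have hs : (s : ℕ) < K := s.isLt
              calc (t : ℕ) * K + (s : ℕ) < (t : ℕ) * K + K := by omega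
                _ = ((t : ℕ) + 1) * K := by ring
                _ ≤ n * K := Nat.mul_le_mul_right K (by omega)
                _ = K * n := Nat.mul_comm n K⟩) := by
  let R : List (Fin d) → Module.End ℂ (Fin D → ℂ) := fun w =>
    LinearMap.toMatrixAlgEquiv'.symm (w.map A).prod
  have hR : IsBlockRep 1 R := ⟨by simp [R], fun u v _ _ => by simp [R]⟩
  obtain ⟨K, hK, F, hF, htr⟩ := hR.exists_full_decomposition le_rfl
  rw [mul_one] at hF htr
  refine ⟨K, hK, ?_⟩
  obtain ⟨L, Dk, B, M, μ, hB, hdiff, hsum⟩ := exists_essentiallyDifferent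
    (fun x : Fin F.length => blockTensor K (F.get x).2)
    fun x => (hF _ (F.get_mem x)).2.isPrimitive_blockTensor (hF _ (F.get_mem x)).1
  refine ⟨L, Dk, B, M, μ, hB, hdiff, fun n hn i => ?_⟩
  have hlen : (List.ofFn i).length = K * n := List.length_ofFn
  have hne : List.ofFn i ≠ [] := by
    rw [← List.length_pos_iff, hlen]
    exact Nat.mul_pos hK hn
  have hV : Vn A (K * n) i = LinearMap.trace ℂ _ (R (List.ofFn i)) := by
    rw [← trace_toMatrixAlgEquiv', AlgEquiv.apply_symm_apply, List.map_ofFn]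
    rfl
  have hblocks : List.ofFn i = (List.ofFn fun t : Fin n => List.ofFn fun s : Fin K => i ⟨t * K + s,
      calc (t : ℕ) * K + s < (t + 1) * K := by rw [add_mul, one_mul]; omega
        _ ≤ n * K := Nat.mul_le_mul_right K t.isLt
        _ = K * n := Nat.mul_comm n K⟩).flatten := by
    rw [List.ofFn_mul']
    exact congrArg List.flatten (congrArg List.ofFn (funext fun t => congrArg List.ofFn
      (funext fun s => congrArg i (Fin.ext (congrArg (· + (s : ℕ)) (mul_comm K (t : ℕ)))))))
  rw [hV, htr _ hne ⟨n, hlen⟩, ← hsum n hn, ← Fin.sum_univ_fun_getElem]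
  refine Finset.sum_congr rfl fun x _ => ?_
  rw [(hF _ (F.get_mem x)).1.Vn_blockTensor, ← hblocks]
  rfl
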